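/- arXiv:2403.19080 — 2 statements merged into one kernel-verified Lean document; each statement's English description precedes it below -/
import Mathlib

section
/- Let α be a type and Ω_X, Ω_Y nonempty finite subsets of α with N_X = |Ω_X|, N_Y = |Ω_Y|, and E = |Ω_X ∩ Ω_Y|. Let X be uniformly distributed on Ω_X and Y uniformly distributed on Ω_Y. Let g : α → L be an arbitrary function into a label type L, let B ∈ L, and let q ∈ [0,1] be a real number with Pr(g(X) = B) ≤ q. Define δ_u = ⌈q·N_X⌉/N_X − q. Then Pr(g(Y) = B) ≤ (N_X / N_Y) · (q + δ_u) + 1 − E/N_Y. -/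
/-- The probability of an event `P` under the uniform distribution on a finite set `Ω`:
`Pr(P) = |{x ∈ Ω : P x}| / |Ω|`. -/
noncomputable def uniformProb {β : Type*} (Ω : Finset β) (P : β → Prop) [DecidablePred P] : ℝ :=
  ((Ω.filter P).card : ℝ) / (Ω.card : ℝ)

/-- The points of `t` satisfying `P` either satisfy `P` in `s` or lie outside `s`. -/
theorem card_filter_add_card_inter_le {α : Type*} [DecidableEq α] (s t : Finset α)
    (P : α → Prop) [DecidablePred P] :
    (t.filter P).card + (s ∩ t).card ≤ (s.filter P).card + t.card := by
  have hsub : t.filter P ⊆ s.filter P ∪ t \ s := by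
    intro x
    simp only [Finset.mem_filter, Finset.mem_union, Finset.mem_sdiff]
    tauto
  have hcard := (Finset.card_le_card hsub).trans (Finset.card_union_le _ _)
  have hsplit := Finset.card_sdiff_add_card_inter t s
  rw [Finset.inter_comm] at hsplit
  omega

/-- Upper-bound step of the paper's Theorem 1: for `X` uniform on `Ω_X` and `Y` uniform on
`Ω_Y`, with `N_X = |Ω_X|`, `N_Y = |Ω_Y|`, `E = |Ω_X ∩ Ω_Y|`, a classifier `g`, a label `B`,
and `q ∈ [0,1]` with `Pr(g(X) = B) ≤ q`, setting `δ_u = ⌈q·N_X⌉/N_X − q`, one has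
`Pr(g(Y) = B) ≤ (N_X/N_Y)·(q + δ_u) + 1 − E/N_Y`. -/
theorem uniform_label_prob_upper_bound {α L : Type*} [DecidableEq α] [DecidableEq L]
    (ΩX ΩY : Finset α) (hX : ΩX.Nonempty) (hY : ΩY.Nonempty)
    (NX NY E : ℕ) (hNX : ΩX.card = NX) (hNY : ΩY.card = NY) (hE : (ΩX ∩ ΩY).card = E)
    (g : α → L) (B : L) (q : ℝ) (hq0 : 0 ≤ q) (hq1 : q ≤ 1)
    (hqB : uniformProb ΩX (fun x => g x = B) ≤ q)
    (δu : ℝ) (hδu : δu = (⌈q * (NX : ℝ)⌉ : ℝ) / (NX : ℝ) - q) :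
    uniformProb ΩY (fun x => g x = B)
      ≤ ((NX : ℝ) / (NY : ℝ)) * (q + δu) + 1 - (E : ℝ) / (NY : ℝ) := by
  subst hNX hNY hE hδu
  have hx : (0 : ℝ) < ΩX.card := by exact_mod_cast hX.card_pos
  have hy : (0 : ℝ) < ΩY.card := by exact_mod_cast hY.card_pos
  unfold uniformProb at hqB ⊢
  rw [div_le_iff₀ hx] at hqB
  have hceil := hqB.trans (Int.le_ceil _)
  have hcount : ((ΩY.filter (fun x => g x = B)).card : ℝ) + (ΩX ∩ ΩY).card
      ≤ (ΩX.filter (fun x => g x = B)).card + ΩY.card := by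
    exact_mod_cast card_filter_add_card_inter_le ΩX ΩY (fun x => g x = B)
  have hrhs : (ΩX.card : ℝ) / ΩY.card
        * (q + ((⌈q * (ΩX.card : ℝ)⌉ : ℝ) / ΩX.card - q)) + 1 - (ΩX ∩ ΩY).card / ΩY.card
      = (⌈q * (ΩX.card : ℝ)⌉ + ΩY.card - (ΩX ∩ ΩY).card) / ΩY.card := by
    field_simp
    ring
  rw [hrhs]
  gcongr
  linarith
end

section
/- Fix T ∈ ℕ. For i = 1,…,T, let m_i be a finite set with n_i = |m_i| and let k_i be a sub-sampling size with k_i ≤ n_i. Let Ω_X be the set of tuples (z_1,…,z_T) where each z_i is a k_i-element subset of m_i, so |Ω_X| = ∏_{i=1}^T C(n_i,k_i), and let the sub-sampled input X be uniformly distributed on Ω_X. Let m'_1,…,m'_T be finite sets (in the same ambient types) with n'_i = |m'_i| and k_i ≤ n'_i, let Ω_Y be the set of tuples (z_1,…,z_T) with each z_i a k_i-element subset of m'_i, let Y be uniformly distributed on Ω_Y, and set e_i = |m_i ∩ m'_i|. Let g be an arbitrary function from tuples to a label type, A a label, and p_A, p_B ∈ [0,1] reals with Pr(g(X) = A) ≥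 p_A and Pr(g(X) = l) ≤ p_B for every label l ≠ A. Define δ_l = p_A − ⌊p_A·∏_{i=1}^T C(n_i,k_i)⌋/∏_{i=1}^T C(n_i,k_i) and δ_u = ⌈p_B·∏_{i=1}^T C(n_i,k_i)⌉/∏_{i=1}^T C(n_i,k_i) − p_B. If (∏_{i=1}^T C(n_i,k_i)/∏_{i=1}^T C(n'_i,k_i))·(p_A − δ_l − 1 + ∏_{i=1}^T C(e_i,k_i)/∏_{i=1}^T C(n_i,k_i)) ≥ (∏_{i=1}^T C(n_i,k_i)/∏_{i=1}^T C(n'_i,k_i))·(p_B + δ_u) + 1 − ∏_{i=1}^T C(e_i,k_i)/∏_{i=1}^T C(n'_i,k_i), then Pr(g(Y) = A) ≥ Pr(g(Y) = l) for every label l ≠ A. -/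
theorem card_filter_add_card_inter_le_s8 {β : Type*} [DecidableEq β] (X Y : Finset β)
    (P : β → Prop) [DecidablePred P] :
    (X.filter P).card + (X ∩ Y).card ≤ (Y.filter P).card + X.card := by
  have hsub : X.filter P ⊆ Y.filter P ∪ X \ Y := fun x hx => by
    simp only [Finset.mem_filter, Finset.mem_union, Finset.mem_sdiff] at hx ⊢
    tauto
  have hle := (Finset.card_le_card hsub).trans (Finset.card_union_le _ _)
  have := Finset.card_sdiff_add_card_inter X Y
  omega

theorem card_piFinset_powersetCard {ι : Type*} [Fintype ι] [DecidableEq ι] {α : ι → Type*}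
    (s : ∀ i, Finset (α i)) (k : ι → ℕ) :
    (Fintype.piFinset fun i => (s i).powersetCard (k i)).card = ∏ i, (s i).card.choose (k i) := by
  simp

theorem piFinset_powersetCard_inter {ι : Type*} [Fintype ι] [DecidableEq ι] {α : ι → Type*}
    [∀ i, DecidableEq (α i)] (s t : ∀ i, Finset (α i)) (k : ι → ℕ) :
    (Fintype.piFinset fun i => (s i).powersetCard (k i)) ∩
        (Fintype.piFinset fun i => (t i).powersetCard (k i)) =
      Fintype.piFinset fun i => (s i ∩ t i).powersetCard (k i) := by
  ext z
  simp only [Finset.mem_inter, Fintype.mem_piFinset, Finset.mem_powersetCard,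
    Finset.subset_inter_iff, ← forall_and]
  exact forall_congr' fun i => by tauto

/-- The paper's Theorem 1 with exact overlap sizes `e i = |m i ∩ m' i|` and perturbed sizes
`n' i = |m' i|`.  `X` is the independent sub-sampling of `k i`-element subsets from the
original modalities `m i` (uniform on the product set `Ω_X` of tuples), and `Y` the analogous
sub-sampling from the perturbed modalities `m' i`.  If `Pr(g(X) = A) ≥ p_A`,
`Pr(g(X) = l) ≤ p_B` for all `l ≠ A`, and the certification condition holds, then
`Pr(g(Y) = A) ≥ Pr(g(Y) = l)` for every label `l ≠ A`. -/
theorem multimodal_certification {T : ℕ} {α : Fin T → Type*} [∀ i, DecidableEq (α i)]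
    {L : Type*} [DecidableEq L]
    (m m' : ∀ i, Finset (α i)) (n n' e k : Fin T → ℕ)
    (hn : ∀ i, (m i).card = n i) (hn' : ∀ i, (m' i).card = n' i)
    (he : ∀ i, (m i ∩ m' i).card = e i)
    (hk : ∀ i, k i ≤ n i) (hk' : ∀ i, k i ≤ n' i)
    (g : (∀ i, Finset (α i)) → L) (A : L) (pA pB : ℝ)
    (hpA0 : 0 ≤ pA) (hpA1 : pA ≤ 1) (hpB0 : 0 ≤ pB) (hpB1 : pB ≤ 1)
    (hA : uniformProb (Fintype.piFinset fun i => (m i).powersetCard (k i))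
        (fun z => g z = A) ≥ pA)
    (hB : ∀ l : L, l ≠ A →
      uniformProb (Fintype.piFinset fun i => (m i).powersetCard (k i))
        (fun z => g z = l) ≤ pB)
    (δl δu : ℝ)
    (hδl : δl = pA - (⌊pA * ∏ i, ((n i).choose (k i) : ℝ)⌋ : ℝ) / ∏ i, ((n i).choose (k i) : ℝ))
    (hδu : δu = (⌈pB * ∏ i, ((n i).choose (k i) : ℝ)⌉ : ℝ) / (∏ i, ((n i).choose (k i) : ℝ)) - pB)
    (hcond : ((∏ i, ((n i).choose (k i) : ℝ)) / (∏ i, ((n' i).choose (k i) : ℝ)))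
          * (pA - δl - 1 + (∏ i, ((e i).choose (k i) : ℝ)) / (∏ i, ((n i).choose (k i) : ℝ)))
      ≥ ((∏ i, ((n i).choose (k i) : ℝ)) / (∏ i, ((n' i).choose (k i) : ℝ))) * (pB + δu)
          + 1 - (∏ i, ((e i).choose (k i) : ℝ)) / (∏ i, ((n' i).choose (k i) : ℝ))) :
    ∀ l : L, l ≠ A →
      uniformProb (Fintype.piFinset fun i => (m' i).powersetCard (k i)) (fun z => g z = A)
        ≥ uniformProb (Fintype.piFinset fun i => (m' i).powersetCard (k i)) (fun z => g z = l) := by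
  intro l hl
  set X := Fintype.piFinset fun i => (m i).powersetCard (k i) with hX
  set Y := Fintype.piFinset fun i => (m' i).powersetCard (k i) with hY
  have hXcard : ∏ i, ((n i).choose (k i) : ℝ) = X.card := by
    rw [hX, card_piFinset_powersetCard]; simp [hn]
  have hYcard : ∏ i, ((n' i).choose (k i) : ℝ) = Y.card := by
    rw [hY, card_piFinset_powersetCard]; simp [hn']
  have hXYcard : ∏ i, ((e i).choose (k i) : ℝ) = (X ∩ Y).card := by
    rw [hX, hY, piFinset_powersetCard_inter, card_piFinset_powersetCard]; simp [he]
  have hXpos : (0 : ℝ) < X.card := by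
    rw [← hXcard]
    exact Finset.prod_pos fun i _ => by exact_mod_cast Nat.choose_pos (hk i)
  have hYpos : (0 : ℝ) < Y.card := by
    rw [← hYcard]
    exact Finset.prod_pos fun i _ => by exact_mod_cast Nat.choose_pos (hk' i)
  rw [hXcard] at hδl hδu
  rw [hXcard, hYcard, hXYcard, hδl, hδu] at hcond
  have hlower : (⌊pA * X.card⌋ : ℝ) ≤ (X.filter fun z => g z = A).card :=
    (Int.floor_le _).trans ((le_div_iff₀ hXpos).mp hA)
  have hupper : ((X.filter fun z => g z = l).card : ℝ) ≤ ⌈pB * X.card⌉ :=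
    ((div_le_iff₀ hXpos).mp (hB l hl)).trans (Int.le_ceil _)
  have hAcard : ((X.filter fun z => g z = A).card : ℝ) + (X ∩ Y).card
      ≤ (Y.filter fun z => g z = A).card + X.card := by
    exact_mod_cast card_filter_add_card_inter_le_s8 X Y fun z => g z = A
  have hlcard : ((Y.filter fun z => g z = l).card : ℝ) + (X ∩ Y).card
      ≤ (X.filter fun z => g z = l).card + Y.card := by
    rw [Finset.inter_comm]
    exact_mod_cast card_filter_add_card_inter_le_s8 Y X fun z => g z = l
  have hcount : (⌈pB * X.card⌉ : ℝ) + Y.card - (X ∩ Y).card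
      ≤ ⌊pA * X.card⌋ - X.card + (X ∩ Y).card := by
    have h := mul_le_mul_of_nonneg_right hcond hYpos.le
    field_simp at h
    rw [mul_comm (X.card : ℝ) pA, mul_comm (X.card : ℝ) pB] at h
    linarith
  exact div_le_div_of_nonneg_right (by linarith) hYpos.le
end
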